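/- Supportedness of stable models of LC-programs: every stable model of an LC-program Π is supported with respect to Π, i.e. for every variable x with t(x) ≠ u there is a supported value for x wrt Π and t. -/

import Mathlib

/- Formalization of the fragment of HT_C built from linear constraints over
   conditional linear terms, as used for LC-programs.  The domain `D` contains
   the integers (witnessed by an `IntDom` structure); besides linear constraints,
   formulas may contain abstract condition-free constraint atoms drawn from `A`
   (with an abstract monotonic denotation `den`). -/

universe u v

namespace HTC

/-- Valuations: partial functions from variables `X` to domain values `D`
    (`none` represents the undefined value `u`). -/
def Val (X D : Type) : Type := X → Option D

/-- `v ⊆ v'` : every variable defined in `v` has the same value in `v'`. -/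
def Val.le {X D : Type} (v v' : Val X D) : Prop :=
  ∀ (x : X) (d : D), v x = some d → v' x = some d

/-- Formulas over an abstract type of atoms `A`. -/
inductive Fml (A : Type u) : Type u where
  | bot  : Fml A
  | atom : A → Fml A
  | and  : Fml A → Fml A → Fml A
  | or   : Fml A → Fml A → Fml A
  | imp  : Fml A → Fml A → Fml A

/-- Negation `¬φ := φ → ⊥`. -/
def Fml.neg {A : Type u} (φ : Fml A) : Fml A := φ.imp .bot

/-- Truth `⊤ := ⊥ → ⊥`. -/
def Fml.top {A : Type u} : Fml A := Fml.neg .bot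

/-- Denotation condition (1): monotonicity of the abstract condition-free atoms. -/
def Mono {X D A : Type} (den : A → Set (Val X D)) : Prop :=
  ∀ (a : A) (v v' : Val X D), v ∈ den a → Val.le v v' → v' ∈ den a

/-- Witness that the domain `D` contains the integers (`𝒟 ⊇ ℤ`). -/
structure IntDom (D : Type) : Type where
  emb : ℤ → D
  toInt : D → Option ℤ
  emb_toInt : ∀ n : ℤ, toInt (emb n) = some n
  toInt_emb : ∀ (d : D) (n : ℤ), toInt d = some n → d = emb n

/-- Condition-free linear terms: built from integer constants and variables
    using `+` and `-`. -/
inductive LTerm (X : Type) : Type where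
  | const : ℤ → LTerm X
  | var : X → LTerm X
  | add : LTerm X → LTerm X → LTerm X
  | sub : LTerm X → LTerm X → LTerm X

/-- Linear terms possibly mentioning the undefined value `u`: the result of
    evaluating the conditional expressions of a conditional linear term. -/
inductive UTerm (X : Type) : Type where
  | const : ℤ → UTerm X
  | var : X → UTerm X
  | undef : UTerm X
  | add : UTerm X → UTerm X → UTerm X
  | sub : UTerm X → UTerm X → UTerm X

/-- Embedding of condition-free linear terms. -/
def LTerm.toU {X : Type} : LTerm X → UTerm X
  | .const n => .const n
  | .var x => .var x
  | .add a b => .add a.toU b.toU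
  | .sub a b => .sub a.toU b.toU

/-- Evaluation of a term by a valuation `v`: an integer when all variables of the
    term take integer values (and no `u` occurs), undefined (`none`) otherwise. -/
def UTerm.eval {X D : Type} (I : IntDom D) (v : Val X D) : UTerm X → Option ℤ
  | .const n => some n
  | .var x => (v x).bind I.toInt
  | .undef => none
  | .add a b => (a.eval I v).bind (fun m => (b.eval I v).map (fun n => m + n))
  | .sub a b => (a.eval I v).bind (fun m => (b.eval I v).map (fun n => m - n))

/-- Evaluation of a condition-free linear term. -/
def LTerm.eval {X D : Type} (I : IntDom D) (v : Val X D) (a : LTerm X) : Option ℤ :=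
  a.toU.eval I v

/-- Condition-free atoms: abstract constraint atoms from `A`, or linear
    constraints `α ≤ β` between condition-free linear terms. -/
abbrev CFAtom (X A : Type) : Type := A ⊕ (LTerm X × LTerm X)

/-- Condition-free formulas. -/
abbrev CFml (X A : Type) : Type := Fml (CFAtom X A)

/-- Satisfaction of a condition-free atom by a valuation; a linear constraint
    `α ≤ β` holds iff both terms evaluate to integers `m ≤ n`. -/
def CFAtomSat {X D A : Type} (I : IntDom D) (den : A → Set (Val X D)) (v : Val X D) :
    CFAtom X A → Prop
  | .inl a => v ∈ den a
  | .inr p => ∃ m n : ℤ, p.1.eval I v = some m ∧ p.2.eval I v = some n ∧ m ≤ n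

/-- HT satisfaction of condition-free formulas. -/
def SatCF {X D A : Type} (I : IntDom D) (den : A → Set (Val X D)) :
    Val X D → Val X D → CFml X A → Prop
  | _, _, .bot => False
  | h, _, .atom a => CFAtomSat I den h a
  | h, t, .and φ ψ => SatCF I den h t φ ∧ SatCF I den h t ψ
  | h, t, .or φ ψ => SatCF I den h t φ ∨ SatCF I den h t ψ
  | h, t, .imp φ ψ =>
      (SatCF I den h t φ → SatCF I den h t ψ) ∧ (SatCF I den t t φ → SatCF I den t t ψ)

/-- Conditional linear terms: linear terms whose subterms may be conditional
    expressions `(s | s' : φ)` with `s`, `s'` condition-free linear terms and `φ`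
    a condition-free formula. -/
inductive CLTerm (X A : Type) : Type where
  | const : ℤ → CLTerm X A
  | var : X → CLTerm X A
  | add : CLTerm X A → CLTerm X A → CLTerm X A
  | sub : CLTerm X A → CLTerm X A → CLTerm X A
  | cond : LTerm X → LTerm X → CFml X A → CLTerm X A

open Classical in
/-- `eval⟨h,t⟩(τ)`: replace each conditional expression `(s | s' : φ)` of `τ` by
    `s` if `⟨h,t⟩ ⊨ φ`, by `s'` if `⟨t,t⟩ ⊭ φ`, and by `u` otherwise. -/
noncomputable def CLTerm.reduce {X D A : Type} (I : IntDom D) (den : A → Set (Val X D))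
    (h t : Val X D) : CLTerm X A → UTerm X
  | .const n => .const n
  | .var x => .var x
  | .add a b => .add (a.reduce I den h t) (b.reduce I den h t)
  | .sub a b => .sub (a.reduce I den h t) (b.reduce I den h t)
  | .cond s s' φ =>
      if SatCF I den h t φ then s.toU
      else if ¬ SatCF I den t t φ then s'.toU
      else .undef

/-- Atoms of the LC fragment: abstract condition-free atoms, or linear constraints
    `α ≤ β` between conditional linear terms. -/
abbrev LAtom (X A : Type) : Type := A ⊕ (CLTerm X A × CLTerm X A)

/-- Formulas of the LC fragment. -/
abbrev LFml (X A : Type) : Type := Fml (LAtom X A)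

/-- `⟨h,t⟩ ⊨ c` for an atom of the LC fragment: for a (conditional) linear
    constraint `α ≤ β` this is `h ∈ ⟦eval⟨h,t⟩(α) ≤ eval⟨h,t⟩(β)⟧`. -/
def LAtomSat {X D A : Type} (I : IntDom D) (den : A → Set (Val X D))
    (h t : Val X D) : LAtom X A → Prop
  | .inl a => h ∈ den a
  | .inr p => ∃ m n : ℤ,
      (p.1.reduce I den h t).eval I h = some m ∧
      (p.2.reduce I den h t).eval I h = some n ∧ m ≤ n

/-- HT_C satisfaction for the LC fragment. -/
def SatL {X D A : Type} (I : IntDom D) (den : A → Set (Val X D)) :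
    Val X D → Val X D → LFml X A → Prop
  | _, _, .bot => False
  | h, t, .atom a => LAtomSat I den h t a
  | h, t, .and φ ψ => SatL I den h t φ ∧ SatL I den h t ψ
  | h, t, .or φ ψ => SatL I den h t φ ∨ SatL I den h t ψ
  | h, t, .imp φ ψ =>
      (SatL I den h t φ → SatL I den h t ψ) ∧ (SatL I den t t φ → SatL I den t t ψ)

/-- The linear constraint `α ≤ β` as a formula. -/
def leF {X A : Type} (α β : CLTerm X A) : LFml X A := Fml.atom (Sum.inr (α, β))

/-- `def(α)`: satisfied in `⟨h,t⟩` iff `h(eval⟨h,t⟩(α)) ∈ ℤ` (encoded as `α ≤ α`). -/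
def defF {X A : Type} (α : CLTerm X A) : LFml X A := leF α α

/-- An assignment `x := α..β`. -/
structure Assign (X A : Type) : Type where
  x : X
  lo : CLTerm X A
  hi : CLTerm X A

/-- `def(A) := def(α) ∧ def(β)` for an assignment `A = (x := α..β)`. -/
def Assign.defF {X A : Type} (a : Assign X A) : LFml X A :=
  (HTC.defF a.lo).and (HTC.defF a.hi)

/-- The non-directional version `Φ(A) := (α ≤ x) ∧ (x ≤ β)`. -/
def Assign.phi {X A : Type} (a : Assign X A) : LFml X A :=
  (leF a.lo (CLTerm.var a.x)).and (leF (CLTerm.var a.x) a.hi)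

/-- The assignment `A = (x := α..β)` stands for the formula
    `¬¬def(A) ∧ (def(A) → (α ≤ x) ∧ (x ≤ β))`. -/
def Assign.fml {X A : Type} (a : Assign X A) : LFml X A :=
  (Fml.neg (Fml.neg a.defF)).and (a.defF.imp a.phi)

end HTC

namespace HTC

/-- Finite conjunction (empty conjunction is `⊤`). -/
def bigAnd {B : Type u} (l : List (Fml B)) : Fml B := l.foldr Fml.and Fml.top

/-- Finite disjunction (empty disjunction is `⊥`). -/
def bigOr {B : Type u} (l : List (Fml B)) : Fml B := l.foldr Fml.or Fml.bot

/-- An LC-rule `A₁ ; … ; Aₙ ← B₁, …, B_m, ¬B_{m+1}, …, ¬B_k` where each `Aᵢ` is an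
    assignment and each `Bⱼ` a linear constraint. -/
structure LCRule (X A : Type) : Type where
  hn : ℕ
  head : Fin hn → Assign X A
  pos : List (CLTerm X A × CLTerm X A)
  negs : List (CLTerm X A × CLTerm X A)

/-- `B(r)`: the conjunction `B₁ ∧ … ∧ B_m ∧ ¬B_{m+1} ∧ … ∧ ¬B_k`. -/
def LCRule.bodyFml {X A : Type} (r : LCRule X A) : LFml X A :=
  bigAnd (r.pos.map (fun c => Fml.atom (Sum.inr c)) ++
          r.negs.map (fun c => Fml.neg (Fml.atom (Sum.inr c))))

/-- The rule `r` as the formula `B(r) → (A₁ ∨ … ∨ Aₙ)`. -/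
def LCRule.fml {X A : Type} (r : LCRule X A) : LFml X A :=
  r.bodyFml.imp (bigOr ((List.finRange r.hn).map (fun i => (r.head i).fml)))

/-- The implication `Ψ_Δ` for a subset `Δ ⊆ H(r)`:
    `(⋁_{A ∈ Δ} Φ(A)) ← B(r) ∧ ⋀_{A ∈ Δ} def(A) ∧ ⋀_{A' ∈ H(r)∖Δ} ¬Φ(A')`. -/
noncomputable def LCRule.psi {X A : Type} (r : LCRule X A) (Δ : Finset (Fin r.hn)) : LFml X A :=
  (bigAnd ([r.bodyFml] ++
           Δ.toList.map (fun i => (r.head i).defF) ++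
           Δᶜ.toList.map (fun i => Fml.neg (r.head i).phi))).imp
  (bigOr (Δ.toList.map (fun i => (r.head i).phi)))

/-- `⟨h,t⟩` is a model of a theory `Γ`. -/
def SatTheoryL {X D A : Type} (I : IntDom D) (den : A → Set (Val X D))
    (h t : Val X D) (Γ : Set (LFml X A)) : Prop :=
  ∀ φ ∈ Γ, SatL I den h t φ

/-- `t` is a stable model of the theory `Γ`: `⟨t,t⟩ ⊨ Γ` and there is no `h ⊊ t`
    with `⟨h,t⟩ ⊨ Γ`. -/
def StableL {X D A : Type} (I : IntDom D) (den : A → Set (Val X D))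
    (Γ : Set (LFml X A)) (t : Val X D) : Prop :=
  SatTheoryL I den t t Γ ∧
  ∀ h : Val X D, Val.le h t → h ≠ t → ¬ SatTheoryL I den h t Γ

/-- Evaluation `v(τ)` of a conditional linear term in the total interpretation
    `⟨v,v⟩`. -/
noncomputable def CLTerm.evalTot {X D A : Type} (I : IntDom D)
    (den : A → Set (Val X D)) (v : Val X D) (τ : CLTerm X A) : Option ℤ :=
  (τ.reduce I den v v).eval I v

/-- Value `d ∈ 𝒟` is supported for variable `x` wrt LC-program `Pgm` and
    valuation `v`:  there are a rule `r ∈ Pgm` and an assignment `x := α..β` in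
    the head of `r` such that
    (1) `v(x) = d` and `v(α) ≤ d ≤ v(β)`, so both `v(α), v(β) ∈ ℤ`;
    (2) `v ⊭ A'` for every assignment `A' = (y := α'..β')` in the head of `r`
        where `y` is a variable different from `x`;
    (3) `v ⊨ B(r)`. -/
def SupportedValue {X D A : Type} (I : IntDom D) (den : A → Set (Val X D))
    (Pgm : Set (LCRule X A)) (v : Val X D) (x : X) (d : D) : Prop :=
  ∃ r ∈ Pgm, ∃ i : Fin r.hn,
    (r.head i).x = x ∧
    (∃ m a b : ℤ, d = I.emb m ∧ v x = some d ∧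
       (r.head i).lo.evalTot I den v = some a ∧
       (r.head i).hi.evalTot I den v = some b ∧ a ≤ m ∧ m ≤ b) ∧
    (∀ j : Fin r.hn, (r.head j).x ≠ x → ¬ SatL I den v v (r.head j).fml) ∧
    SatL I den v v r.bodyFml

end HTC

namespace HTC

theorem UTerm.eval_mono {X D : Type} (I : IntDom D) {h t : Val X D} (hle : Val.le h t)
    (a : UTerm X) : ∀ m : ℤ, a.eval I h = some m → a.eval I t = some m := by
  induction a with
  | const n => intro m hm; simpa [UTerm.eval] using hm
  | var x =>
    intro m hm
    simp only [UTerm.eval, Option.bind_eq_some_iff] at hm ⊢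
    obtain ⟨d, hd, hm⟩ := hm
    exact ⟨d, hle x d hd, hm⟩
  | undef => intro m hm; simp [UTerm.eval] at hm
  | add a b iha ihb =>
    intro m hm
    simp only [UTerm.eval, Option.bind_eq_some_iff, Option.map_eq_some_iff] at hm ⊢
    obtain ⟨p, hp, q, hq, e⟩ := hm
    exact ⟨p, iha p hp, q, ihb q hq, e⟩
  | sub a b iha ihb =>
    intro m hm
    simp only [UTerm.eval, Option.bind_eq_some_iff, Option.map_eq_some_iff] at hm ⊢
    obtain ⟨p, hp, q, hq, e⟩ := hm
    exact ⟨p, iha p hp, q, ihb q hq, e⟩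

theorem SatCF_mono {X D A : Type} (I : IntDom D) {den : A → Set (Val X D)} (h1 : Mono den)
    {h t : Val X D} (hle : Val.le h t) (φ : CFml X A) :
    SatCF I den h t φ → SatCF I den t t φ := by
  induction φ with
  | bot => intro hs; simp [SatCF] at hs
  | atom a =>
    intro hs
    simp only [SatCF] at hs ⊢
    cases a with
    | inl a => exact h1 a h t hs hle
    | inr p =>
      obtain ⟨m, n, hm, hn, hmn⟩ := hs
      exact ⟨m, n, UTerm.eval_mono I hle _ m hm, UTerm.eval_mono I hle _ n hn, hmn⟩
  | and φ ψ ih1 ih2 =>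
    intro hs
    simp only [SatCF] at hs ⊢
    exact ⟨ih1 hs.1, ih2 hs.2⟩
  | or φ ψ ih1 ih2 =>
    intro hs
    simp only [SatCF] at hs ⊢
    exact hs.imp ih1 ih2
  | imp φ ψ ih1 ih2 =>
    intro hs
    simp only [SatCF] at hs ⊢
    exact ⟨hs.2, hs.2⟩

theorem CLTerm.eval_mono {X D A : Type} (I : IntDom D) {den : A → Set (Val X D)} (h1 : Mono den)
    {h t : Val X D} (hle : Val.le h t) (a : CLTerm X A) :
    ∀ m : ℤ, (a.reduce I den h t).eval I h = some m →
      (a.reduce I den t t).eval I t = some m := by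
  induction a with
  | const n => intro m hm; simpa [CLTerm.reduce, UTerm.eval] using hm
  | var x => intro m hm; exact UTerm.eval_mono I hle (.var x) m hm
  | add a b iha ihb =>
    intro m hm
    simp only [CLTerm.reduce, UTerm.eval, Option.bind_eq_some_iff, Option.map_eq_some_iff] at hm ⊢
    obtain ⟨p, hp, q, hq, e⟩ := hm
    exact ⟨p, iha p hp, q, ihb q hq, e⟩
  | sub a b iha ihb =>
    intro m hm
    simp only [CLTerm.reduce, UTerm.eval, Option.bind_eq_some_iff, Option.map_eq_some_iff] at hm ⊢
    obtain ⟨p, hp, q, hq, e⟩ := hm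
    exact ⟨p, iha p hp, q, ihb q hq, e⟩
  | cond s s' φ =>
    intro m hm
    simp only [CLTerm.reduce] at hm ⊢
    by_cases c1 : SatCF I den h t φ
    · rw [if_pos c1] at hm
      rw [if_pos (SatCF_mono I h1 hle φ c1)]
      exact UTerm.eval_mono I hle _ m hm
    · rw [if_neg c1] at hm
      by_cases c2 : SatCF I den t t φ
      · rw [if_neg (not_not.mpr c2)] at hm
        simp [UTerm.eval] at hm
      · rw [if_pos c2] at hm
        rw [if_neg c2, if_pos c2]
        exact UTerm.eval_mono I hle _ m hm

theorem SatL_mono {X D A : Type} (I : IntDom D) {den : A → Set (Val X D)} (h1 : Mono den)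
    {h t : Val X D} (hle : Val.le h t) (φ : LFml X A) :
    SatL I den h t φ → SatL I den t t φ := by
  induction φ with
  | bot => intro hs; simp [SatL] at hs
  | atom a =>
    intro hs
    simp only [SatL] at hs ⊢
    cases a with
    | inl a => exact h1 a h t hs hle
    | inr p =>
      obtain ⟨m, n, hm, hn, hmn⟩ := hs
      exact ⟨m, n, CLTerm.eval_mono I h1 hle _ m hm, CLTerm.eval_mono I h1 hle _ n hn, hmn⟩
  | and φ ψ ih1 ih2 =>
    intro hs
    simp only [SatL] at hs ⊢
    exact ⟨ih1 hs.1, ih2 hs.2⟩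
  | or φ ψ ih1 ih2 =>
    intro hs
    simp only [SatL] at hs ⊢
    exact hs.imp ih1 ih2
  | imp φ ψ ih1 ih2 =>
    intro hs
    simp only [SatL] at hs ⊢
    exact ⟨hs.2, hs.2⟩

theorem SatL_bigOr {X D A : Type} (I : IntDom D) (den : A → Set (Val X D))
    (h t : Val X D) (l : List (LFml X A)) :
    SatL I den h t (bigOr l) ↔ ∃ φ ∈ l, SatL I den h t φ := by
  induction l with
  | nil => simp [bigOr, SatL]
  | cons a l ih =>
    have e : bigOr (a :: l) = Fml.or a (bigOr l) := rfl
    rw [e]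
    simp only [SatL, ih, List.mem_cons, exists_eq_or_imp]

/-- Classical content of an assignment satisfied in a total interpretation. -/
theorem Assign.fml_total {X D A : Type} (I : IntDom D) (den : A → Set (Val X D))
    (t : Val X D) (a : Assign X A) (hs : SatL I den t t a.fml) :
    ∃ p m q : ℤ, (a.lo.reduce I den t t).eval I t = some p ∧
      (t a.x).bind I.toInt = some m ∧
      (a.hi.reduce I den t t).eval I t = some q ∧ p ≤ m ∧ m ≤ q := by
  simp only [Assign.fml, Fml.neg, SatL] at hs
  have hd : SatL I den t t a.defF := by tauto
  have hp : SatL I den t t a.phi := hs.2.2 hd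
  simp only [Assign.phi, leF, SatL, LAtomSat, CLTerm.reduce, UTerm.eval] at hp
  obtain ⟨⟨p, m, h1, h2, h3⟩, ⟨m', q, h4, h5, h6⟩⟩ := hp
  have : m = m' := by rw [h2] at h4; exact Option.some.inj h4
  subst this
  exact ⟨p, m, q, h1, h2, h5, h3, h6⟩

/-- An assignment true in `⟨t,t⟩` stays true in `⟨h,t⟩` if `h` keeps its variable. -/
theorem Assign.fml_down {X D A : Type} (I : IntDom D) {den : A → Set (Val X D)} (h1 : Mono den)
    {h t : Val X D} (hle : Val.le h t) (a : Assign X A) (hx : h a.x = t a.x)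
    (hs : SatL I den t t a.fml) : SatL I den h t a.fml := by
  obtain ⟨p, m, q, e1, e2, e3, l1, l2⟩ := Assign.fml_total I den t a hs
  have hs0 := hs
  simp only [Assign.fml, Fml.neg, SatL] at hs ⊢
  have hd : SatL I den t t a.defF := by tauto
  refine ⟨⟨fun hn => hn.2 hd, fun hn => hn.2 hd⟩, ?_, hs.2.2⟩
  intro hdh
  simp only [Assign.defF, defF, leF, SatL, LAtomSat] at hdh
  obtain ⟨⟨p', _, f1, _, _⟩, ⟨q', _, f2, _, _⟩⟩ := hdh
  have g1 := CLTerm.eval_mono I h1 hle _ _ f1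
  have g2 := CLTerm.eval_mono I h1 hle _ _ f2
  rw [e1] at g1
  rw [e3] at g2
  cases g1
  cases g2
  simp only [Assign.phi, leF, SatL, LAtomSat, CLTerm.reduce, UTerm.eval, hx]
  exact ⟨⟨p, m, f1, e2, l1⟩, ⟨m, q, e2, f2, l2⟩⟩

/-- Proposition 3/`prop:lc.supported`: every stable model of an
    LC-program is supported: for every variable `x` with `t(x) ≠ u` (i.e.
    `t x = some d`), the value `d` is a supported value for `x` wrt `Pgm` and `t`. -/
theorem lc_supported {X D A : Type} (I : IntDom D) (den : A → Set (Val X D))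
    (h1 : Mono den) (Pgm : Set (LCRule X A)) (t : Val X D)
    (hstable : StableL I den (LCRule.fml '' Pgm) t) :
    ∀ (x : X) (d : D), t x = some d → SupportedValue I den Pgm t x d := by
  intro x d hxd
  classical
  let h : Val X D := fun y => if y = x then none else t y
  have hne_eq : ∀ y, y ≠ x → h y = t y := fun y hy => if_neg hy
  have hx : h x = none := if_pos rfl
  have hle : Val.le h t := by
    intro y e hy
    by_cases hyx : y = x
    · subst hyx
      rw [hx] at hy
      cases hy
    · rwa [hne_eq y hyx] at hy
  have hne : h ≠ t := by
    intro he
    have : h x = some d := by rw [he]; exact hxd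
    rw [hx] at this
    cases this
  have hnot := hstable.2 h hle hne
  unfold SatTheoryL at hnot
  push Not at hnot
  obtain ⟨_, ⟨r, hr, rfl⟩, hrn⟩ := hnot
  have hrt : SatL I den t t r.fml := hstable.1 _ ⟨r, hr, rfl⟩
  simp only [LCRule.fml, SatL] at hrn hrt
  have hB : SatL I den h t r.bodyFml := by tauto
  have hH : ¬ SatL I den h t
      (bigOr ((List.finRange r.hn).map (fun i => (r.head i).fml))) := by tauto
  have hBt := SatL_mono I h1 hle _ hB
  have hHt := hrt.2 hBt
  rw [SatL_bigOr] at hH hHt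
  have key : ∀ j : Fin r.hn, (r.head j).x ≠ x → ¬ SatL I den t t (r.head j).fml := by
    intro j hj hs
    exact hH ⟨_, List.mem_map.mpr ⟨j, List.mem_finRange j, rfl⟩,
      Assign.fml_down I h1 hle _ (hne_eq _ hj) hs⟩
  obtain ⟨_, hmem, hs⟩ := hHt
  obtain ⟨i, _, rfl⟩ := List.mem_map.mp hmem
  have hix : (r.head i).x = x := by
    by_contra hc
    exact key i hc hs
  obtain ⟨p, m, q, e1, e2, e3, l1, l2⟩ := Assign.fml_total I den t _ hs
  rw [hix, hxd] at e2
  exact ⟨r, hr, i, hix, ⟨m, p, q, I.toInt_emb d m e2, hxd, e1, e3, l1, l2⟩, key, hBt⟩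

end HTC
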